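/- Let n ≥ 2 and let d, a be positive integers, and set g = gcd(a,d). If n ∉ Γ(d/g), then the triple (n,d,a) is good. In particular, if n ∉ Γ(d), then (n,d,a) is good for every positive integer a. -/

import Mathlib

open MvPolynomial

/-- A sequence of polynomials is a regular sequence if each element is a
nonzerodivisor modulo the ideal generated by the previous ones. -/
def RegSeq {n : ℕ} (fs : List (MvPolynomial (Fin n) ℂ)) : Prop :=
  ∀ i : Fin fs.length, ∀ g : MvPolynomial (Fin n) ℂ,
    g * fs.get i ∈ Ideal.span {p | p ∈ fs.take i.1} →
    g ∈ Ideal.span {p | p ∈ fs.take i.1}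

/-- The sequence `x_1^d - x_n^d, …, x_{n-1}^d - x_n^d` in `ℂ[x_1,…,x_n]`. -/
noncomputable def powDiffSeq (n d : ℕ) : List (MvPolynomial (Fin n) ℂ) :=
  (List.finRange (n - 1)).map fun i =>
    X (⟨i.1, by have := i.isLt; omega⟩ : Fin n) ^ d -
    X (⟨n - 1, by have := i.isLt; omega⟩ : Fin n) ^ d

/-- The triple `(n,d,a)` is good if there is a homogeneous symmetric polynomial `f`
of degree `a` such that `x_1^d - x_n^d, …, x_{n-1}^d - x_n^d, f` is a regular
sequence. -/
def GoodTriple (n d a : ℕ) : Prop :=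
  ∃ f : MvPolynomial (Fin n) ℂ, f.IsHomogeneous a ∧ f.IsSymmetric ∧
    RegSeq (powDiffSeq n d ++ [f])

/-- `Γ(m)`: the numerical semigroup generated by the prime divisors of `m`. -/
def Gamma (m : ℕ) : AddSubmonoid ℕ :=
  AddSubmonoid.closure {p : ℕ | p.Prime ∧ p ∣ m}


/-- A polynomial vanishing at all points with `i`-th coordinate in `S i` lies in any ideal
containing the products `∏ s ∈ S i, (X i - s)`; here the points have polynomial coordinates. -/
lemma mem_ideal_of_vanishing {σ : Type*} [Finite σ] {R : Type*} [CommRing R] [IsDomain R]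
    (S : σ → Finset (MvPolynomial σ R)) (hS : ∀ i, (S i).Nonempty)
    (J : Ideal (MvPolynomial σ R)) (hJ : ∀ i, ∏ s ∈ S i, (X i - s) ∈ J)
    (g : MvPolynomial σ R) (hg : ∀ x : σ → MvPolynomial σ R, (∀ i, x i ∈ S i) → aeval x g = 0) :
    g ∈ J := by
  obtain ⟨h, -, hh⟩ := combinatorial_nullstellensatz_exists_linearCombination S hS (map C g)
    (fun x hx => by
      have := hg x hx
      rwa [aeval_def, ← eval_map] at this)
  have h1 : eval X (map C g) = g := by
    rw [eval_map]; exact eval₂_eta g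
  rw [← h1, hh, Finsupp.linearCombination_apply, Finsupp.sum, map_sum]
  refine Ideal.sum_mem _ fun i _ => ?_
  rw [smul_eq_mul, map_mul, map_prod]
  refine Ideal.mul_mem_left _ _ ?_
  simpa using hJ i

open Classical in
/-- The multiples of `y` by the `d`-th roots of unity. -/
noncomputable def rootMultiples {n : ℕ} (d : ℕ) (y : MvPolynomial (Fin n) ℂ) :
    Finset (MvPolynomial (Fin n) ℂ) :=
  (Polynomial.nthRootsFinset d (1 : MvPolynomial (Fin n) ℂ)).image fun ζ => ζ * y

lemma isPrimitiveRoot_C_exp {σ : Type*} {d : ℕ} (hd : 0 < d) :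
    IsPrimitiveRoot (C (Complex.exp (2 * Real.pi * Complex.I / d)) : MvPolynomial σ ℂ) d :=
  (Complex.isPrimitiveRoot_exp d hd.ne').map_of_injective (C_injective _ _)

lemma mem_rootMultiples {n d : ℕ} (hd : 0 < d) {y s : MvPolynomial (Fin n) ℂ} :
    s ∈ rootMultiples d y ↔ ∃ ζ : ℂ, ζ ^ d = 1 ∧ C ζ * y = s := by
  simp only [rootMultiples, Finset.mem_image, Polynomial.mem_nthRootsFinset hd]
  constructor
  · rintro ⟨z, hz, rfl⟩
    have : NeZero d := ⟨hd.ne'⟩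
    obtain ⟨i, -, rfl⟩ := (isPrimitiveRoot_C_exp hd).eq_pow_of_pow_eq_one hz
    refine ⟨Complex.exp (2 * Real.pi * Complex.I / d) ^ i, ?_, by rw [C_pow]⟩
    rw [pow_right_comm, (Complex.isPrimitiveRoot_exp d hd.ne').pow_eq_one, one_pow]
  · rintro ⟨ζ, hζ, rfl⟩
    exact ⟨C ζ, by rw [← C_pow, hζ, C_1], rfl⟩

lemma prod_rootMultiples {n d : ℕ} (hd : 0 < d) (x : MvPolynomial (Fin n) ℂ)
    {y : MvPolynomial (Fin n) ℂ} (hy : y ≠ 0) :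
    ∏ s ∈ rootMultiples d y, (x - s) = x ^ d - y ^ d := by
  classical
  rw [(isPrimitiveRoot_C_exp hd).pow_sub_pow_eq_prod_sub_mul _ _ hd, rootMultiples,
    Finset.prod_image fun _ _ _ _ h => mul_right_cancel₀ hy h]

/-- The ideal generated by `x_i ^ d - x_l ^ d` for `i < k`. -/
noncomputable def powDiffIdeal {n : ℕ} (d : ℕ) (l : Fin n) (k : ℕ) :
    Ideal (MvPolynomial (Fin n) ℂ) :=
  Ideal.span {p | ∃ i : Fin n, i.1 < k ∧ p = X i ^ d - X l ^ d}

/-- An element is a nonzerodivisor modulo `powDiffIdeal d l k` as soon as it does not vanish on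
any of the linear subspaces `x_i = ζ_i x_l`, `i < k`. -/
lemma mem_powDiffIdeal_of_mul_mem {n d : ℕ} (hd : 0 < d) {l : Fin n} {k : ℕ} (hk : k ≤ l.1)
    {f g : MvPolynomial (Fin n) ℂ}
    (hf : ∀ ζ : Fin n → ℂ, (∀ i, ζ i ^ d = 1) →
      aeval (fun i => if i.1 < k then C (ζ i) * X l else X i) f ≠ 0)
    (hfg : g * f ∈ powDiffIdeal d l k) : g ∈ powDiffIdeal d l k := by
  classical
  refine mem_ideal_of_vanishing
    (fun i => if i.1 < k then rootMultiples d (X l) else {X i}) ?_ _ ?_ _ ?_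
  · intro i
    split_ifs
    · exact ⟨X l, (mem_rootMultiples hd).2 ⟨1, by simp, by simp⟩⟩
    · simp
  · intro i
    split_ifs with hi
    · rw [prod_rootMultiples hd _ (X_ne_zero l)]
      exact Ideal.subset_span ⟨i, hi, rfl⟩
    · simp
  · intro x hx
    have hz : ∀ i : Fin n, ∃ ζ : ℂ, ζ ^ d = 1 ∧ x i = if i.1 < k then C ζ * X l else X i := by
      intro i
      have := hx i
      split_ifs at this ⊢ with hi
      · obtain ⟨ζ, h1, h2⟩ := (mem_rootMultiples hd).1 this
        exact ⟨ζ, h1, h2.symm⟩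
      · exact ⟨1, by simp, by simpa using this⟩
    choose ζ hζ hxζ using hz
    obtain rfl : x = _ := funext hxζ
    have hker : powDiffIdeal d l k ≤
        RingHom.ker (aeval (fun i : Fin n => if i.1 < k then C (ζ i) * X l else X i) :
          MvPolynomial (Fin n) ℂ →ₐ[ℂ] MvPolynomial (Fin n) ℂ) := by
      refine Ideal.span_le.2 ?_
      rintro _ ⟨i, hi, rfl⟩
      have hl : ¬ l.1 < k := by omega
      simp [RingHom.mem_ker, hi, hl, mul_pow, ← C_pow, hζ]
    have := hker hfg
    rw [RingHom.mem_ker, map_mul] at this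
    exact (mul_eq_zero.1 this).resolve_right (hf ζ hζ)

lemma span_take_powDiffSeq {n d : ℕ} (hn : 2 ≤ n) {k : ℕ} (hk : k ≤ n - 1)
    (f : MvPolynomial (Fin n) ℂ) :
    Ideal.span {p | p ∈ (powDiffSeq n d ++ [f]).take k} =
      powDiffIdeal d ⟨n - 1, by omega⟩ k := by
  unfold powDiffIdeal
  congr 1
  ext p
  rw [List.take_append_of_le_length (by simpa [powDiffSeq] using hk)]
  simp only [powDiffSeq, Set.mem_ofPred_eq, List.mem_take_iff_getElem]
  constructor
  · rintro ⟨j, hj, rfl⟩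
    simp at hj
    exact ⟨⟨j, by omega⟩, by simp; omega, by simp⟩
  · rintro ⟨i, hi, rfl⟩
    exact ⟨i.1, by simp; omega, by simp⟩

/-- If the power sum `∑ ζ_i ^ a` is nonzero for all choices of `d`-th roots of unity `ζ_i`, then
the triple `(n,d,a)` is good. -/
lemma goodTriple_of_sum_pow_ne_zero {n d a : ℕ} (hn : 2 ≤ n) (hd : 0 < d)
    (h : ∀ ζ : Fin n → ℂ, (∀ i, ζ i ^ d = 1) → ∑ i, ζ i ^ a ≠ 0) : GoodTriple n d a := by
  refine ⟨psum (Fin n) ℂ a, ?_, psum_isSymmetric _ _ _, ?_⟩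
  · exact IsHomogeneous.sum _ _ _ fun i _ => isHomogeneous_X_pow i a
  · intro i g hg
    have hlen : (powDiffSeq n d ++ [psum (Fin n) ℂ a]).length = n - 1 + 1 := by
      simp [powDiffSeq]
    have hi := i.isLt
    rw [span_take_powDiffSeq hn (by omega)] at hg ⊢
    refine mem_powDiffIdeal_of_mul_mem hd (by simp; omega) ?_ hg
    intro ζ hζ
    rcases Nat.lt_or_ge i.1 (n - 1) with hlt | hge
    · have hget : (powDiffSeq n d ++ [psum (Fin n) ℂ a]).get i =
          X ⟨i.1, by omega⟩ ^ d - X ⟨n - 1, by omega⟩ ^ d := by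
        rw [List.get_eq_getElem, List.getElem_append_left (by simpa [powDiffSeq] using hlt)]
        simp [powDiffSeq]
      have hl : ¬ n - 1 < i.1 := by omega
      rw [hget]
      simp only [map_sub, map_pow, aeval_X, lt_irrefl, if_false, hl]
      intro h0
      have := congrArg (eval (fun j : Fin n => if j.1 = n - 1 then (1 : ℂ) else 0)) h0
      simp [hlt.ne, hd.ne'] at this
    · have hget : (powDiffSeq n d ++ [psum (Fin n) ℂ a]).get i = psum (Fin n) ℂ a := by
        rw [List.get_eq_getElem, List.getElem_append_right (by simpa [powDiffSeq] using hge)]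
        simp
      rw [hget]
      intro h0
      have := congrArg (eval (fun j : Fin n => (1 : ℂ))) h0
      have hi' : i.1 = n - 1 := by omega
      refine h (fun j => if j.1 < n - 1 then ζ j else 1) ?_ ?_
      · intro j; split_ifs <;> simp [hζ]
      · simp only [psum, map_sum, map_zero] at this
        rw [← this]
        refine Finset.sum_congr rfl fun j _ => ?_
        simp only [hi', map_pow, aeval_X]
        split_ifs <;> simp
section RootsOfUnity

open IntermediateField

lemma natDegree_minpoly_mul_totient {m k : ℕ} (hm : 0 < m) (hk : 0 < k) {η ω ζ : ℂ}
    (hη : IsPrimitiveRoot η m) (hζ : IsPrimitiveRoot ζ k) (h : ℚ⟮η, ω⟯ = ℚ⟮ζ⟯)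
    (hω : IsIntegral ℚ⟮η⟯ ω) :
    m.totient * (minpoly ℚ⟮η⟯ ω).natDegree = k.totient := by
  have key : ∀ {n : ℕ} {x : ℂ}, 0 < n → IsPrimitiveRoot x n →
      Module.finrank ℚ ℚ⟮x⟯ = n.totient := by
    intro n x hn hx
    rw [adjoin.finrank ((hx.isIntegral hn).tower_top), ← Polynomial.cyclotomic_eq_minpoly_rat hx hn,
      Polynomial.natDegree_cyclotomic]
  rw [← key hm hη, ← key hk hζ, ← adjoin.finrank hω, Module.finrank_mul_finrank, ← h,
    ← adjoin_simple_adjoin_simple]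
  rfl

lemma adjoin_pair_eq_of_pow {k : ℕ} (hk : 0 < k) {η ω ζ : ℂ} (hζ : IsPrimitiveRoot ζ k)
    (hη : η ^ k = 1) (hω : ω ^ k = 1) (h : ζ ∈ ℚ⟮η, ω⟯) : ℚ⟮η, ω⟯ = ℚ⟮ζ⟯ := by
  have : NeZero k := ⟨hk.ne'⟩
  refine le_antisymm (adjoin_le_iff.2 ?_) (adjoin_simple_le_iff.2 h)
  have hmem : ∀ x : ℂ, x ^ k = 1 → x ∈ ℚ⟮ζ⟯ := by
    intro x hx
    obtain ⟨i, -, rfl⟩ := hζ.eq_pow_of_pow_eq_one hx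
    exact pow_mem (mem_adjoin_simple_self ℚ ζ) i
  rintro x (rfl | rfl)
  · exact hmem _ hη
  · exact hmem _ hω

lemma sum_mem_adjoin {m : ℕ} (hm : 0 < m) {η : ℂ} (hη : IsPrimitiveRoot η m) {s : Multiset ℂ}
    (hs : ∀ z ∈ s, z ^ m = 1) : s.sum ∈ ℚ⟮η⟯ := by
  have : NeZero m := ⟨hm.ne'⟩
  refine multiset_sum_mem _ fun z hz => ?_
  obtain ⟨i, -, rfl⟩ := hη.eq_pow_of_pow_eq_one (hs z hz)
  exact pow_mem (mem_adjoin_simple_self ℚ η) i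

lemma linearIndependent_pow_of_natDegree {K : IntermediateField ℚ ℂ} {ω : ℂ} {q : ℕ}
    (h : (minpoly K ω).natDegree = q) {c : Fin q → ℂ} (hc : ∀ i, c i ∈ K)
    (h0 : ∑ i : Fin _, ω ^ (i : ℕ) * c i = 0) (i : Fin q) : c i = 0 := by
  subst h
  have hli := Fintype.linearIndependent_iff.1 (linearIndependent_pow (K := K) ω)
    (fun i => ⟨c i, hc i⟩) (by
      rw [← h0]
      refine Finset.sum_congr rfl fun j _ => ?_
      rw [Algebra.smul_def, mul_comm]
      rfl) i
  exact congrArg Subtype.val hli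

lemma exists_mul_pow_of_forall {p m k : ℕ} {ω : ℂ}
    (hdec : ∀ z : ℂ, z ^ k = 1 → ∃ i : Fin p, ∃ w : ℂ, w ^ m = 1 ∧ z = ω ^ (i : ℕ) * w)
    (s : Multiset ℂ) (hs : ∀ z ∈ s, z ^ k = 1) :
    ∃ t : Fin p → Multiset ℂ, (∀ i, ∀ z ∈ t i, z ^ m = 1) ∧
      s = ∑ i, (t i).map (ω ^ (i : ℕ) * ·) := by
  induction s using Multiset.induction with
  | empty => exact ⟨fun _ => 0, by simp, by simp⟩
  | cons a s ih =>
    obtain ⟨t, ht, rfl⟩ := ih fun z hz => hs z (Multiset.mem_cons_of_mem hz)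
    obtain ⟨i, w, hw, rfl⟩ := hdec a (hs a (Multiset.mem_cons_self _ _))
    refine ⟨t + Pi.single i {w}, ?_, ?_⟩
    · intro j z hz
      rcases Multiset.mem_add.1 hz with h | h
      · exact ht j z h
      · by_cases hij : j = i
        · subst hij
          rw [Pi.single_eq_same, Multiset.mem_singleton] at h
          rw [h, hw]
        · simp [Pi.single_eq_of_ne hij] at h
    · simp only [Pi.add_apply, Multiset.map_add, Finset.sum_add_distrib]
      rw [Finset.sum_eq_single i (f := fun j : Fin p =>
          Multiset.map (ω ^ (j : ℕ) * ·) ((Pi.single i {w} : Fin p → Multiset ℂ) j))]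
      · rw [Pi.single_eq_same, Multiset.map_singleton, add_comm, Multiset.singleton_add]
      · intro j _ hj
        simp [Pi.single_eq_of_ne hj]
      · simp

/-- `s` is the disjoint union of the translates of the `t i` by `ω ^ i`. -/
def IsCosetDecomp {p : ℕ} (m : ℕ) (ω : ℂ) (s : Multiset ℂ) (t : Fin p → Multiset ℂ) : Prop :=
  (∀ i, ∀ z ∈ t i, z ^ m = 1) ∧ s = ∑ i, (t i).map (ω ^ (i : ℕ) * ·)

lemma IsCosetDecomp.sum_eq {p m : ℕ} {ω : ℂ} {s : Multiset ℂ} {t : Fin p → Multiset ℂ}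
    (h : IsCosetDecomp m ω s t) : s.sum = ∑ i : Fin p, ω ^ (i : ℕ) * (t i).sum := by
  rw [h.2, ← Multiset.coe_sumAddMonoidHom, map_sum]
  refine Finset.sum_congr rfl fun i _ => ?_
  simpa using Multiset.sum_map_mul_left (s := t i) (a := ω ^ (i : ℕ)) (f := id)

lemma IsCosetDecomp.card_eq {p m : ℕ} {ω : ℂ} {s : Multiset ℂ} {t : Fin p → Multiset ℂ}
    (h : IsCosetDecomp m ω s t) : s.card = ∑ i, (t i).card := by
  rw [h.2, Multiset.card_sum]
  simp

lemma IsCosetDecomp.le {p m : ℕ} {ω : ℂ} {x y : Multiset ℂ} {u v : Fin p → Multiset ℂ}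
    (hx : IsCosetDecomp m ω x u) (hy : IsCosetDecomp m ω y v) (h : ∀ i, u i ≤ v i) : x ≤ y := by
  rw [hx.2, hy.2]
  exact Finset.sum_le_sum fun i _ => Multiset.map_le_map (h i)

/-- Splitting off a prime that divides the remaining order. -/
lemma exists_cosetDecomp_of_dvd {p m : ℕ} (hp : p.Prime) (hm : 0 < m) (hpm : p ∣ m) :
    ∃ ω : ℂ, (∀ s : Multiset ℂ, (∀ z ∈ s, z ^ (p * m) = 1) →
        ∃ t : Fin p → Multiset ℂ, IsCosetDecomp m ω s t) ∧
      ∀ (x y : Multiset ℂ) (u v : Fin p → Multiset ℂ), IsCosetDecomp m ω x u →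
        IsCosetDecomp m ω y v → x.sum = y.sum → ∀ i, (u i).sum = (v i).sum := by
  have hk : 0 < p * m := Nat.mul_pos hp.pos hm
  have : NeZero (p * m) := ⟨hk.ne'⟩
  have hω := Complex.isPrimitiveRoot_exp (p * m) hk.ne'
  set ω := Complex.exp (2 * Real.pi * Complex.I / (p * m : ℕ))
  have hη : IsPrimitiveRoot (ω ^ p) m := hω.pow hk rfl
  refine ⟨ω, exists_mul_pow_of_forall ?_, ?_⟩
  · intro z hz
    obtain ⟨i, -, rfl⟩ := hω.eq_pow_of_pow_eq_one hz
    refine ⟨⟨i % p, Nat.mod_lt _ hp.pos⟩, (ω ^ p) ^ (i / p), ?_, ?_⟩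
    · rw [pow_right_comm, hη.pow_eq_one, one_pow]
    · rw [← pow_mul, ← pow_add, Nat.mod_add_div]
  · intro x y u v hx hy hxy i
    have hdeg : (minpoly ℚ⟮ω ^ p⟯ ω).natDegree = p := by
      have h1 := natDegree_minpoly_mul_totient hm hk hη hω
        (adjoin_pair_eq_of_pow hk hω (by rw [pow_right_comm, hω.pow_eq_one, one_pow])
          hω.pow_eq_one (subset_adjoin _ _ (by simp))) (hω.isIntegral hk).tower_top
      rw [Nat.totient_mul_of_prime_of_dvd hp hpm, mul_comm] at h1
      exact Nat.eq_of_mul_eq_mul_right (Nat.totient_pos.2 hm) h1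
    refine sub_eq_zero.1 (linearIndependent_pow_of_natDegree hdeg (c := fun i =>
      (u i).sum - (v i).sum) (fun i => sub_mem (sum_mem_adjoin hm hη (hx.1 i))
        (sum_mem_adjoin hm hη (hy.1 i))) ?_ i)
    simp only [mul_sub, Finset.sum_sub_distrib]
    rw [← hx.sum_eq, ← hy.sum_eq, hxy, sub_self]

/-- Splitting off a prime that does not divide the remaining order. -/
lemma exists_cosetDecomp_of_not_dvd {p m : ℕ} (hp : p.Prime) (hm : 0 < m) (hpm : ¬ p ∣ m) :
    ∃ ω : ℂ, (∀ s : Multiset ℂ, (∀ z ∈ s, z ^ (p * m) = 1) →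
        ∃ t : Fin p → Multiset ℂ, IsCosetDecomp m ω s t) ∧
      ∀ (x y : Multiset ℂ) (u v : Fin p → Multiset ℂ), IsCosetDecomp m ω x u →
        IsCosetDecomp m ω y v → x.sum = y.sum →
        ∀ i j, (u i).sum + (v j).sum = (u j).sum + (v i).sum := by
  have hk : 0 < p * m := Nat.mul_pos hp.pos hm
  have : NeZero (p * m) := ⟨hk.ne'⟩
  have hcop : p.Coprime m := (Nat.Prime.coprime_iff_not_dvd hp).2 hpm
  have hω := Complex.isPrimitiveRoot_exp p hp.ne_zero
  set ω := Complex.exp (2 * Real.pi * Complex.I / p)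
  have hη := Complex.isPrimitiveRoot_exp m hm.ne'
  set η := Complex.exp (2 * Real.pi * Complex.I / m)
  have hζ : IsPrimitiveRoot (ω * η) (p * m) := by
    have := (Commute.all ω η).orderOf_mul_eq_mul_orderOf_of_coprime
      (by rwa [← hω.eq_orderOf, ← hη.eq_orderOf])
    rw [← hω.eq_orderOf, ← hη.eq_orderOf] at this
    rw [← this]
    exact IsPrimitiveRoot.orderOf _
  refine ⟨ω, exists_mul_pow_of_forall ?_, ?_⟩
  · intro z hz
    obtain ⟨i, -, rfl⟩ := hζ.eq_pow_of_pow_eq_one hz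
    refine ⟨⟨i % p, Nat.mod_lt _ hp.pos⟩, η ^ i, ?_, ?_⟩
    · rw [pow_right_comm, hη.pow_eq_one, one_pow]
    · rw [mul_pow, ← pow_mod_orderOf ω i, ← hω.eq_orderOf]
  · intro x y u v hx hy hxy
    obtain ⟨q, rfl⟩ : ∃ q, p = q + 1 := ⟨p - 1, by have := hp.pos; omega⟩
    have hdeg : (minpoly ℚ⟮η⟯ ω).natDegree = q := by
      have h1 := natDegree_minpoly_mul_totient (ω := ω) hm hk hη hζ
        (adjoin_pair_eq_of_pow hk hζ (by rw [mul_comm, pow_mul, hη.pow_eq_one, one_pow])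
          (by rw [pow_mul, hω.pow_eq_one, one_pow])
          (mul_mem (subset_adjoin _ _ (by simp)) (subset_adjoin _ _ (by simp))))
          (hω.isIntegral hp.pos).tower_top
      rw [Nat.totient_mul hcop, Nat.totient_prime hp, mul_comm] at h1
      simpa using Nat.eq_of_mul_eq_mul_right (Nat.totient_pos.2 hm) h1
    have hgeom : ∑ i : Fin (q + 1), ω ^ (i : ℕ) = 0 := by
      rw [Fin.sum_univ_eq_sum_range (fun i => ω ^ i)]
      exact hω.geom_sum_eq_zero hp.one_lt
    set c : Fin (q + 1) → ℂ := fun i => (u i).sum - (v i).sum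
    have hc : ∀ i, c i ∈ ℚ⟮η⟯ := fun i => sub_mem (sum_mem_adjoin hm hη (hx.1 i))
        (sum_mem_adjoin hm hη (hy.1 i))
    have h0 : ∑ i : Fin _, ω ^ (i : ℕ) * c i = 0 := by
      simp only [c, mul_sub, Finset.sum_sub_distrib]
      rw [← hx.sum_eq, ← hy.sum_eq, hxy, sub_self]
    have hlast : ∀ i, c i = c (Fin.last q) := by
      have h1 : ∑ i : Fin q, ω ^ (i : ℕ) * (c i.castSucc - c (Fin.last q)) = 0 := by
        have h2 : ∑ i : Fin (q + 1), ω ^ (i : ℕ) * (c i - c (Fin.last q)) = 0 := by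
          simp only [mul_sub, Finset.sum_sub_distrib]
          rw [h0, ← Finset.sum_mul, hgeom]
          simp
        rw [Fin.sum_univ_castSucc] at h2
        simpa using h2
      intro i
      refine Fin.lastCases rfl (fun i => ?_) i
      exact sub_eq_zero.1 (linearIndependent_pow_of_natDegree hdeg
        (fun i => sub_mem (hc _) (hc _)) h1 i)
    intro i j
    have : c i = c j := (hlast i).trans (hlast j).symm
    linear_combination this

end RootsOfUnity

section VanishingSums

lemma mem_gamma_of_le {P Q m n : ℕ} (hP : P.Prime) (hQ : Q.Prime) (hPQ : P ≠ Q) (hPm : P ∣ m)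
    (hQm : Q ∣ m) (h : (P - 1) * (Q - 1) ≤ n) : n ∈ Gamma m := by
  have hlt : P * Q - P - Q < n := by
    obtain ⟨a, rfl⟩ := Nat.exists_eq_add_of_le hP.two_le
    obtain ⟨b, rfl⟩ := Nat.exists_eq_add_of_le hQ.two_le
    have h1 : (2 + a - 1) * (2 + b - 1) = a * b + a + b + 1 := by
      rw [show 2 + a - 1 = a + 1 by omega, show 2 + b - 1 = b + 1 by omega]; ring
    have h2 : (2 + a) * (2 + b) = a * b + 2 * a + 2 * b + 4 := by ring
    omega
  have := (frobeniusNumber_iff.1 (frobeniusNumber_pair ((Nat.coprime_primes hP hQ).2 hPQ)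
    hP.one_lt hQ.one_lt)).2 n hlt
  refine AddSubmonoid.closure_mono ?_ this
  rintro q (rfl | rfl)
  · exact ⟨hP, hPm⟩
  · exact ⟨hQ, hQm⟩

lemma gamma_mono {m k : ℕ} (h : m ∣ k) : Gamma m ≤ Gamma k :=
  AddSubmonoid.closure_mono fun _ hp => ⟨hp.1, hp.2.trans h⟩

/-- Numerical part of `le_or_le_card_sum`. -/
lemma mul_le_of_coset_bounds {P Q k kj l N y p : ℕ} (hPQ : P < Q) (hQp : Q ≤ p) (hkP : k < P)
    (hkj : kj ≤ k) (hN : p ≤ 1 + N + (k - kj)) (hy : (P - (kj + l)) * (Q - 1) ≤ y) :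
    (P - k) * (Q - 1) ≤ y + N * l := by
  obtain ⟨t, rfl⟩ := Nat.exists_eq_add_of_le hkj
  obtain ⟨e, rfl⟩ := Nat.exists_eq_add_of_lt hkP
  obtain ⟨f, rfl⟩ := Nat.exists_eq_add_of_lt hPQ
  have hN' : kj + e + f + 1 ≤ N := by omega
  rw [show kj + t + e + 1 - (kj + t) = e + 1 by omega,
    show kj + t + e + 1 + f + 1 - 1 = kj + t + e + f + 1 by omega]
  rw [show kj + t + e + 1 + f + 1 - 1 = kj + t + e + f + 1 by omega,
    show kj + t + e + 1 - (kj + l) = t + e + 1 - l by omega] at hy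
  have hNl : (kj + e + f + 1) * l ≤ N * l := Nat.mul_le_mul_right _ hN'
  rcases le_total l (t + e + 1) with hl | hl
  · obtain ⟨g, hg⟩ := Nat.exists_eq_add_of_le hl
    rw [hg, Nat.add_sub_cancel_left] at hy
    nlinarith [Nat.zero_le (t * (kj + f)), Nat.zero_le (t * g)]
  · nlinarith [Nat.mul_le_mul_left (kj + e + f + 1) hl, Nat.zero_le (t * (kj + f))]

lemma exists_eq_zero_of_sum_card_lt {p : ℕ} {u : Fin p → Multiset ℂ}
    (h : ∑ i, (u i).card < p) : ∃ i, u i = 0 := by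
  by_contra! hne
  have := Finset.card_nsmul_le_sum Finset.univ (fun i => (u i).card) 1
    fun i _ => Multiset.card_pos.2 (hne i)
  rw [Finset.card_univ, Fintype.card_fin, smul_eq_mul, mul_one] at this
  omega

/-- If `u i - v i` has the same sum for all `i`, and the dichotomy for sums of roots of unity holds
for order `m`, then it holds for the whole families. -/
lemma le_or_le_card_sum {P Q p m : ℕ} (hPQ : P < Q) (hQp : Q ≤ p)
    (H : ∀ a b : Multiset ℂ, (∀ z ∈ a, z ^ m = 1) → (∀ z ∈ b, z ^ m = 1) → a.sum = b.sum →
      a ≤ b ∨ (P - a.card) * (Q - 1) ≤ b.card)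
    {u v : Fin p → Multiset ℂ} (hu : ∀ i, ∀ z ∈ u i, z ^ m = 1) (hv : ∀ i, ∀ z ∈ v i, z ^ m = 1)
    (huv : ∀ i j, (u i).sum + (v j).sum = (u j).sum + (v i).sum) :
    (∀ i, u i ≤ v i) ∨ (P - ∑ i, (u i).card) * (Q - 1) ≤ ∑ i, (v i).card := by
  classical
  rcases le_or_gt P (∑ i, (u i).card) with hk | hk
  · right; simp [Nat.sub_eq_zero_of_le hk]
  have hcount : ∀ A : Finset (Fin p),
      A.card ≤ (A.filter fun i => u i = 0).card + ∑ i ∈ A, (u i).card := by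
    intro A
    rw [Finset.card_filter, ← Finset.sum_add_distrib, Finset.card_eq_sum_ones]
    refine Finset.sum_le_sum fun i _ => ?_
    split_ifs with h
    · omega
    · have := Multiset.card_pos.2 h
      omega
  have hne : (Finset.univ.filter fun i => u i = 0).Nonempty := by
    obtain ⟨i, hi⟩ := exists_eq_zero_of_sum_card_lt (hk.trans_le (hPQ.le.trans hQp))
    exact ⟨i, by simpa using hi⟩
  obtain ⟨i₀, hi₀, hmin⟩ := Finset.exists_min_image _ (fun i => (v i).card) hne
  rw [Finset.mem_filter] at hi₀
  by_cases hall : ∀ j, u j + v i₀ ≤ v j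
  · exact Or.inl fun j => (Multiset.le_add_right _ _).trans (hall j)
  right
  push Not at hall
  obtain ⟨j, hj⟩ := hall
  have hbound := (H (u j + v i₀) (v j)
    (fun z hz => (Multiset.mem_add.1 hz).elim (hu j z) (hv i₀ z)) (hv j) (by
      rw [Multiset.sum_add, huv j i₀, hi₀.2, Multiset.sum_zero, zero_add])).resolve_left hj
  rw [Multiset.card_add] at hbound
  have hsu := Finset.add_sum_erase Finset.univ (fun i => (u i).card) (Finset.mem_univ j)
  have hsv := Finset.add_sum_erase Finset.univ (fun i => (v i).card) (Finset.mem_univ j)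
  have hA := hcount (Finset.univ.erase j)
  rw [Finset.card_erase_of_mem (Finset.mem_univ j), Finset.card_univ, Fintype.card_fin] at hA
  have hN : ((Finset.univ.erase j).filter fun i => u i = 0).card * (v i₀).card ≤
      ∑ i ∈ Finset.univ.erase j, (v i).card := by
    rw [← smul_eq_mul]
    refine (Finset.card_nsmul_le_sum _ _ _ fun i hi => ?_).trans
      (Finset.sum_le_sum_of_subset (Finset.filter_subset _ _))
    exact hmin i (by simpa using (Finset.mem_filter.1 hi).2)
  exact (mul_le_of_coset_bounds (N := ((Finset.univ.erase j).filter fun i => u i = 0).card)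
    hPQ hQp hk (by omega) (by omega) hbound).trans (by omega)

lemma eq_replicate_of_pow_one {s : Multiset ℂ} (hs : ∀ z ∈ s, z ^ 1 = 1) :
    s = Multiset.replicate s.card 1 :=
  Multiset.eq_replicate_card.2 fun z hz => by simpa using hs z hz

lemma eq_of_sum_eq_of_pow_one {x y : Multiset ℂ} (hx : ∀ z ∈ x, z ^ 1 = 1)
    (hy : ∀ z ∈ y, z ^ 1 = 1) (hxy : x.sum = y.sum) : x = y := by
  rw [eq_replicate_of_pow_one hx, eq_replicate_of_pow_one hy] at hxy ⊢
  simp only [Multiset.sum_replicate, nsmul_eq_mul, mul_one, Nat.cast_inj] at hxy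
  rw [hxy]

/-- If all prime factors of `m` other than `P` are at least `Q > P`, and two sums `x`, `y` of
`m`-th roots of unity agree, then either `x` is a subsum of `y` or `y` is long. -/
lemma le_or_le_card_of_sum_eq {P Q : ℕ} (hPQ : P < Q) (m : ℕ) (hm : 0 < m)
    (hprimes : ∀ q : ℕ, q.Prime → q ∣ m → q = P ∨ Q ≤ q) (x y : Multiset ℂ)
    (hx : ∀ z ∈ x, z ^ m = 1) (hy : ∀ z ∈ y, z ^ m = 1) (hxy : x.sum = y.sum) :
    x ≤ y ∨ (P - x.card) * (Q - 1) ≤ y.card := by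
  induction m using Nat.strong_induction_on generalizing x y with
  | _ m ih =>
  have ih' : ∀ p m' : ℕ, p.Prime → m = p * m' → ∀ a b : Multiset ℂ, (∀ z ∈ a, z ^ m' = 1) →
      (∀ z ∈ b, z ^ m' = 1) → a.sum = b.sum → a ≤ b ∨ (P - a.card) * (Q - 1) ≤ b.card := by
    rintro p m' hp rfl
    have hm' : 0 < m' := Nat.pos_of_mul_pos_left hm
    exact ih m' (lt_mul_of_one_lt_left hm' hp.one_lt) hm'
      (fun q hq hqm => hprimes q hq (hqm.mul_left p))
  by_cases hsq : ∃ p : ℕ, p.Prime ∧ p * p ∣ m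
  · obtain ⟨p, hp, r, rfl⟩ := hsq
    rw [mul_assoc] at hx hy hm ih'
    obtain ⟨ω, hdec, hrel⟩ :=
      exists_cosetDecomp_of_dvd hp (Nat.pos_of_mul_pos_left hm) (Dvd.intro r rfl)
    obtain ⟨u, hu⟩ := hdec x hx
    obtain ⟨v, hv⟩ := hdec y hy
    by_cases hle : ∀ i, u i ≤ v i
    · exact Or.inl (hu.le hv hle)
    push Not at hle
    obtain ⟨i, hi⟩ := hle
    have hb := (ih' p _ hp rfl (u i) (v i) (hu.1 i) (hv.1 i)
      (hrel x y u v hu hv hxy i)).resolve_left hi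
    right
    rw [hu.card_eq, hv.card_eq]
    have h1 := Finset.single_le_sum (f := fun i => (u i).card) (fun _ _ => Nat.zero_le _)
      (Finset.mem_univ i)
    have h2 := Finset.single_le_sum (f := fun i => (v i).card) (fun _ _ => Nat.zero_le _)
      (Finset.mem_univ i)
    exact (Nat.mul_le_mul_right _ (Nat.sub_le_sub_left h1 P)).trans (hb.trans h2)
  push Not at hsq
  by_cases hQ : ∃ p : ℕ, p.Prime ∧ p ∣ m ∧ Q ≤ p
  · obtain ⟨p, hp, ⟨r, rfl⟩, hQp⟩ := hQ
    obtain ⟨ω, hdec, hrel⟩ := exists_cosetDecomp_of_not_dvd hp (Nat.pos_of_mul_pos_left hm)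
      (fun h => hsq p hp (Nat.mul_dvd_mul_left p h))
    obtain ⟨u, hu⟩ := hdec x hx
    obtain ⟨v, hv⟩ := hdec y hy
    rw [hu.card_eq, hv.card_eq]
    exact (le_or_le_card_sum hPQ hQp (ih' p r hp rfl) hu.1 hv.1
      (hrel x y u v hu hv hxy)).imp_left (hu.le hv)
  push Not at hQ
  by_cases h1 : m = 1
  · subst h1
    exact Or.inl (eq_of_sum_eq_of_pow_one hx hy hxy).le
  have hall : ∀ q : ℕ, q.Prime → q ∣ m → q = P := fun q hq hqm =>
    (hprimes q hq hqm).resolve_right (hQ q hq hqm).not_ge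
  have hPp := hall _ (Nat.minFac_prime h1) (Nat.minFac_dvd m)
  have hP : P.Prime := hPp ▸ Nat.minFac_prime h1
  obtain ⟨r, rfl⟩ : P ∣ m := hPp ▸ Nat.minFac_dvd m
  obtain rfl : r = 1 := by
    by_contra hr1
    have hrP := hall _ (Nat.minFac_prime hr1) ((Nat.minFac_dvd r).mul_left P)
    exact hsq P hP (Nat.mul_dvd_mul_left P (hrP ▸ Nat.minFac_dvd r))
  obtain ⟨ω, hdec, hrel⟩ := exists_cosetDecomp_of_not_dvd hP one_pos hP.not_dvd_one
  obtain ⟨u, hu⟩ := hdec x hx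
  obtain ⟨v, hv⟩ := hdec y hy
  rcases le_or_gt P x.card with hk | hk
  · right; simp [Nat.sub_eq_zero_of_le hk]
  obtain ⟨i, hi⟩ := exists_eq_zero_of_sum_card_lt (hu.card_eq ▸ hk)
  refine Or.inl (hu.le hv fun j => ?_)
  have : u j + v i = v j := eq_of_sum_eq_of_pow_one
    (fun z hz => (Multiset.mem_add.1 hz).elim (hu.1 j z) (hv.1 i z)) (hv.1 j) (by
      rw [Multiset.sum_add, hrel x y u v hu hv hxy j i, hi, Multiset.sum_zero, zero_add])
  exact this ▸ Multiset.le_add_right _ _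

/-- If `t i` is contained in every `t j` and all these multisets have the same sum, then the total
size is `p * (t i).card` plus sizes of vanishing sums of `m`-th roots of unity. -/
lemma sum_card_mem_gamma {p m k : ℕ} (hp : p.Prime) (hpk : p ∣ k) (hmk : m ∣ k)
    (ih : ∀ s : Multiset ℂ, (∀ z ∈ s, z ^ m = 1) → s.sum = 0 → s.card ∈ Gamma m)
    {t : Fin p → Multiset ℂ} (ht : ∀ i, ∀ z ∈ t i, z ^ m = 1) (i : Fin p)
    (hle : ∀ j, t i ≤ t j) (hsum : ∀ j, (t i).sum = (t j).sum) :
    ∑ j, (t j).card ∈ Gamma k := by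
  have hcard : ∀ j, (t j).card = (t i).card + (t j - t i).card := fun j => by
    rw [← Multiset.card_add, add_tsub_cancel_of_le (hle j)]
  rw [Finset.sum_congr rfl fun j _ => hcard j, Finset.sum_add_distrib, Finset.sum_const,
    Finset.card_univ, Fintype.card_fin, smul_eq_mul, mul_comm, ← smul_eq_mul]
  have hpG : p ∈ Gamma k := AddSubmonoid.subset_closure ⟨hp, hpk⟩
  refine add_mem (nsmul_mem hpG _)
    (sum_mem fun j _ => gamma_mono hmk (ih _ (fun z hz => ht j z ?_) ?_))
  · exact Multiset.mem_of_le tsub_le_self hz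
  · have := congrArg Multiset.sum (add_tsub_cancel_of_le (hle j))
    rw [Multiset.sum_add, hsum j] at this
    simpa using this

/-- The **Lam–Leung theorem**: the length of a vanishing sum of `m`-th roots of unity is an
`ℕ`-linear combination of the prime divisors of `m`. -/
theorem card_mem_gamma_of_sum_eq_zero (m : ℕ) (hm : 0 < m) (s : Multiset ℂ)
    (hs : ∀ z ∈ s, z ^ m = 1) (h0 : s.sum = 0) : s.card ∈ Gamma m := by
  induction m using Nat.strong_induction_on generalizing s with
  | _ m ih =>
  have ih' : ∀ p m' : ℕ, p.Prime → m = p * m' → ∀ a : Multiset ℂ, (∀ z ∈ a, z ^ m' = 1) →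
      a.sum = 0 → a.card ∈ Gamma m' := by
    rintro p m' hp rfl
    have hm' : 0 < m' := Nat.pos_of_mul_pos_left hm
    exact ih m' (lt_mul_of_one_lt_left hm' hp.one_lt) hm'
  by_cases hsq : ∃ p : ℕ, p.Prime ∧ p * p ∣ m
  · obtain ⟨p, hp, r, rfl⟩ := hsq
    rw [mul_assoc] at hs hm ih' ⊢
    obtain ⟨ω, hdec, hrel⟩ :=
      exists_cosetDecomp_of_dvd hp (Nat.pos_of_mul_pos_left hm) (Dvd.intro r rfl)
    obtain ⟨t, ht⟩ := hdec s hs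
    have hz : IsCosetDecomp (p * r) ω 0 (fun _ : Fin p => 0) := ⟨by simp, by simp⟩
    rw [ht.card_eq]
    exact sum_mem fun i _ => gamma_mono (Dvd.intro_left p rfl) (ih' p _ hp rfl (t i) (ht.1 i)
      (by simpa using hrel s 0 t _ ht hz (by simpa using h0) i))
  push Not at hsq
  by_cases h1 : m = 1
  · subst h1
    rw [eq_replicate_of_pow_one hs] at h0 ⊢
    simp only [Multiset.sum_replicate, nsmul_eq_mul, mul_one, Nat.cast_eq_zero] at h0
    simp [h0]
  have split : ∀ p r : ℕ, p.Prime → m = p * r → ∃ t : Fin p → Multiset ℂ,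
      (∀ i, ∀ z ∈ t i, z ^ r = 1) ∧ s.card = ∑ i, (t i).card ∧
        (∀ i j, (t i).sum = (t j).sum) := by
    rintro p r hp rfl
    obtain ⟨ω, hdec, hrel⟩ := exists_cosetDecomp_of_not_dvd hp (Nat.pos_of_mul_pos_left hm)
      (fun h => hsq p hp (Nat.mul_dvd_mul_left p h))
    obtain ⟨t, ht⟩ := hdec s hs
    have hz : IsCosetDecomp r ω 0 (fun _ : Fin p => 0) := ⟨by simp, by simp⟩
    exact ⟨t, ht.1, ht.card_eq, fun i j => by
      simpa using hrel s 0 t _ ht hz (by simpa using h0) i j⟩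
  have hP := Nat.minFac_prime h1
  set P := m.minFac with hPdef
  obtain ⟨r, hr⟩ : P ∣ m := Nat.minFac_dvd m
  by_cases hr1 : r = 1
  · subst hr1
    obtain ⟨t, ht, hcard, hsum⟩ := split P 1 hP hr
    rw [hcard]
    let i : Fin P := ⟨0, hP.pos⟩
    exact sum_card_mem_gamma hP (Dvd.intro _ hr.symm) (one_dvd m) (ih' P 1 hP hr) ht i
      (fun j => (eq_of_sum_eq_of_pow_one (ht i) (ht j) (hsum i j)).le) (hsum i)
  have hQ := Nat.minFac_prime hr1
  set Q := r.minFac with hQdef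
  have hQr : Q ∣ r := Nat.minFac_dvd r
  have hQm : Q ∣ m := hr ▸ hQr.mul_left P
  have hPQ : P < Q := by
    refine lt_of_le_of_ne (Nat.minFac_le_of_dvd hQ.two_le hQm) fun h => hsq P hP ?_
    rw [hr]
    exact Nat.mul_dvd_mul_left P (h ▸ hQr)
  obtain ⟨m', hm'⟩ := hQm
  have hm'm : m' ∣ m := hm' ▸ Dvd.intro_left Q rfl
  have hm'0 : 0 < m' := Nat.pos_of_dvd_of_pos hm'm hm
  have hprimes : ∀ q : ℕ, q.Prime → q ∣ m' → q = P ∨ Q ≤ q := by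
    intro q hq hqm
    have : q ∣ P * r := hr ▸ hqm.trans hm'm
    rcases hq.dvd_mul.1 this with h | h
    · exact Or.inl ((Nat.prime_dvd_prime_iff_eq hq hP).1 h)
    · exact Or.inr (Nat.minFac_le_of_dvd hq.two_le h)
  obtain ⟨t, ht, hcard, hsum⟩ := split Q m' hQ hm'
  rw [hcard]
  obtain ⟨i, -, hmin⟩ := Finset.exists_min_image Finset.univ (fun i => (t i).card)
    ⟨⟨0, hQ.pos⟩, Finset.mem_univ _⟩
  by_cases hle : ∀ j, t i ≤ t j
  · exact sum_card_mem_gamma hQ (Dvd.intro _ hm'.symm) hm'm (ih' Q m' hQ hm') ht i hle (hsum i)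
  push Not at hle
  obtain ⟨j, hj⟩ := hle
  have hb := (le_or_le_card_of_sum_eq hPQ m' hm'0 hprimes (t i) (t j) (ht i) (ht j)
    (hsum i j)).resolve_left hj
  refine mem_gamma_of_le hP hQ hPQ.ne (Dvd.intro _ hr.symm) (Dvd.intro _ hm'.symm) ?_
  rw [← Finset.add_sum_erase Finset.univ (fun i => (t i).card) (Finset.mem_univ j)]
  have h2 := Finset.card_nsmul_le_sum (Finset.univ.erase j) (fun i => (t i).card) _
    fun l _ => hmin l (Finset.mem_univ l)
  rw [Finset.card_erase_of_mem (Finset.mem_univ j), Finset.card_univ, Fintype.card_fin,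
    smul_eq_mul] at h2
  calc (P - 1) * (Q - 1) ≤ (P - (t i).card + (t i).card) * (Q - 1) :=
        Nat.mul_le_mul_right _ (by omega)
    _ ≤ _ := by rw [add_mul, mul_comm (t i).card]; exact Nat.add_le_add hb h2

end VanishingSums

theorem n_notin_Gamma (n d : ℕ) (hn : 2 ≤ n) (hd : 0 < d) :
    (∀ a : ℕ, 0 < a → n ∉ Gamma (d / Nat.gcd a d) → GoodTriple n d a) ∧
    (n ∉ Gamma d → ∀ a : ℕ, 0 < a → GoodTriple n d a) := by
  have main : ∀ a : ℕ, 0 < a → n ∉ Gamma (d / Nat.gcd a d) → GoodTriple n d a := by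
    intro a _ hna
    refine goodTriple_of_sum_pow_ne_zero hn hd fun ζ hζ h0 => hna ?_
    have hg := Nat.gcd_dvd_right a d
    have := card_mem_gamma_of_sum_eq_zero (d / Nat.gcd a d)
      (Nat.div_pos (Nat.le_of_dvd hd hg) (Nat.gcd_pos_of_pos_right a hd))
      (Finset.univ.val.map fun i => ζ i ^ a) ?_ h0
    · simpa using this
    · intro z hz
      obtain ⟨i, -, rfl⟩ := Multiset.mem_map.1 hz
      obtain ⟨b, hb⟩ := Nat.gcd_dvd_left a d
      rw [← pow_mul]
      have hab : a * (d / Nat.gcd a d) = d * b := by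
        calc a * (d / Nat.gcd a d) = Nat.gcd a d * b * (d / Nat.gcd a d) := by rw [← hb]
          _ = d * b := by rw [mul_right_comm, Nat.mul_div_cancel' hg]
      rw [hab, pow_mul, hζ, one_pow]
  exact ⟨main, fun hnd a ha => main a ha fun h =>
    hnd (gamma_mono (Nat.div_dvd_of_dvd (Nat.gcd_dvd_right a d)) h)⟩
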